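/- arXiv:1702.07171 — 2 statements merged into one kernel-verified Lean document; each statement's English description precedes it below -/
import Mathlib

section
/- Let m ≥ 1 be an integer and let p, q, ε be real numbers with 1 ≤ p < m, 1 ≤ q ≤ mp/(m − p) and ε > 0. Then there exists C > 0 such that for every function v : ℝ^m → ℝ of class C¹ and every measurable set A contained in the open unit ball B(0,1) with volume(A) > ε, one has (∫_{B(0,1)} |v(x)|^q dx)^{1/q} ≤ C · ((∫_{B(0,1)} ‖fderiv ℝ v x‖^p dx)^{1/p} + volume(A)⁻¹ · ∫_A |v(x)| dx). -/
open MeasureTheory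

open scoped ENNReal NNReal

lemma ENNReal.rpow_lintegral_le {α : Type*} [MeasurableSpace α] {ν : Measure α} {f : α → ℝ≥0∞}
    (hf : Measurable f) {p : ℝ} (hp : 1 ≤ p) :
    (∫⁻ x, f x ∂ν) ^ p ≤ (∫⁻ x, f x ^ p ∂ν) * ν Set.univ ^ (p - 1) := by
  have hp0 : 0 < p := by linarith
  have h := eLpNorm'_le_eLpNorm'_mul_rpow_measure_univ (μ := ν) zero_lt_one hp
    hf.aestronglyMeasurable
  simp only [eLpNorm', enorm_eq_self, ENNReal.rpow_one, div_one] at h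
  calc (∫⁻ x, f x ∂ν) ^ p
      ≤ ((∫⁻ x, f x ^ p ∂ν) ^ (1 / p) * ν Set.univ ^ (1 - 1 / p)) ^ p := by gcongr
    _ = _ := by
      rw [ENNReal.mul_rpow_of_nonneg _ _ hp0.le, ← ENNReal.rpow_mul, ← ENNReal.rpow_mul,
        one_div_mul_cancel hp0.ne', ENNReal.rpow_one, sub_mul, one_div_mul_cancel hp0.ne', one_mul]

section Poincare

variable {E : Type*} [NormedAddCommGroup E] [NormedSpace ℝ E] [FiniteDimensional ℝ E]
  [MeasurableSpace E] [BorelSpace E] (μ : Measure E) [μ.IsAddHaarMeasure]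

lemma lintegral_comp_add_smul_le {g : E → ℝ≥0∞} (hg : Measurable g) {s : Set E}
    (hs : MeasurableSet s) (c : E) {r : ℝ} (hr : r ≠ 0) (hc : ∀ y ∈ s, c + r • y ∈ s) :
    ∫⁻ y in s, g (c + r • y) ∂μ
      ≤ ENNReal.ofReal |(r ^ Module.finrank ℝ E)⁻¹| * ∫⁻ y in s, g y ∂μ := by
  have hgs : Measurable (s.indicator g) := hg.indicator hs
  calc ∫⁻ y in s, g (c + r • y) ∂μ
      = ∫⁻ y in s, s.indicator g (c + r • y) ∂μ :=
        setLIntegral_congr_fun hs fun y hy ↦ by simp [Set.indicator_of_mem (hc y hy)]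
    _ ≤ ∫⁻ y, s.indicator g (c + r • y) ∂μ := setLIntegral_le_lintegral _ _
    _ = ∫⁻ z, s.indicator g (c + z) ∂(μ.map (r • ·)) := by
        rw [lintegral_map (by fun_prop) (by fun_prop)]
    _ = _ := by
        rw [Measure.map_addHaar_smul μ hr, lintegral_smul_measure, smul_eq_mul,
          lintegral_add_left_eq_self, lintegral_indicator hs]

lemma lintegral_lintegral_segment_le {g : E → ℝ≥0∞} (hg : Measurable g) {s : Set E}
    (hs : MeasurableSet s) (hconv : Convex ℝ s) {t : ℝ} (ht : t ∈ Set.Icc (0 : ℝ) 1) :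
    ∫⁻ x in s, ∫⁻ y in s, g (x + t • (y - x)) ∂μ ∂μ
      ≤ 2 ^ Module.finrank ℝ E * μ s * ∫⁻ x in s, g x ∂μ := by
  have key : ∀ t : ℝ, t ∈ Set.Icc (1 / 2 : ℝ) 1 →
      ∫⁻ x in s, ∫⁻ y in s, g (x + t • (y - x)) ∂μ ∂μ
        ≤ 2 ^ Module.finrank ℝ E * μ s * ∫⁻ x in s, g x ∂μ := by
    intro t ⟨ht0, ht1⟩
    have htpos : 0 < t := by linarith
    calc ∫⁻ x in s, ∫⁻ y in s, g (x + t • (y - x)) ∂μ ∂μ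
        ≤ ∫⁻ _ in s, 2 ^ Module.finrank ℝ E * ∫⁻ x in s, g x ∂μ ∂μ := by
          refine setLIntegral_mono' hs fun x hx ↦ ?_
          have h := lintegral_comp_add_smul_le μ hg hs ((1 - t) • x) htpos.ne'
            fun y hy ↦ hconv hx hy (by linarith) htpos.le (by ring)
          have h1 : ∀ y, x + t • (y - x) = (1 - t) • x + t • y := fun y ↦ by module
          simp_rw [h1]
          refine h.trans ?_
          gcongr
          rw [abs_of_pos (by positivity), ← inv_pow, ENNReal.ofReal_pow (by positivity)]
          gcongr
          rw [show (2 : ℝ≥0∞) = ENNReal.ofReal 2 by simp]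
          apply ENNReal.ofReal_le_ofReal
          rw [inv_le_comm₀ htpos two_pos]
          linarith
      _ = _ := by
          rw [setLIntegral_const]; ring
  rcases le_total (1 / 2) t with h | h
  · exact key t ⟨h, ht.2⟩
  · rw [lintegral_lintegral_swap (Measurable.aemeasurable (by fun_prop))]
    have h1 : ∀ x y : E, x + t • (y - x) = y + (1 - t) • (x - y) := fun x y ↦ by module
    simp_rw [h1]
    exact key (1 - t) ⟨by linarith, by linarith [ht.1]⟩

omit [FiniteDimensional ℝ E] [MeasurableSpace E] [BorelSpace E] in
lemma enorm_sub_le_lintegral_fderiv_segment {v : E → ℝ} (hv : ContDiff ℝ 1 v) (x y : E) :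
    ‖v y - v x‖ₑ ≤ ∫⁻ t in Set.Icc (0 : ℝ) 1, ‖fderiv ℝ v (x + t • (y - x))‖ₑ * ‖y - x‖ₑ := by
  have hd : ∀ t : ℝ, HasDerivAt (fun t : ℝ ↦ v (x + t • (y - x)))
      (fderiv ℝ v (x + t • (y - x)) (y - x)) t := fun t ↦ by
    have h1 : HasDerivAt (fun t : ℝ ↦ x + t • (y - x)) (y - x) t := by
      simpa using ((hasDerivAt_id t).smul_const (y - x)).const_add x
    exact (hv.differentiable one_ne_zero _).hasFDerivAt.comp_hasDerivAt t h1
  have h := enorm_sub_le_lintegral_deriv_of_contDiffOn_Icc (a := 0) (b := 1)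
    (f := fun t : ℝ ↦ v (x + t • (y - x))) (by fun_prop) zero_le_one
  simp only [one_smul, zero_smul, add_zero, add_sub_cancel, fun t ↦ (hd t).deriv] at h
  exact h.trans (lintegral_mono fun t ↦ ContinuousLinearMap.le_opENorm _ _)

/-- On a bounded convex set, the double `L^p` integral of the differences of a `C¹` function is
controlled by the `L^p` norm of its derivative. -/
lemma lintegral_lintegral_enorm_sub_rpow_le {v : E → ℝ} (hv : ContDiff ℝ 1 v) {s : Set E}
    (hs : MeasurableSet s) (hconv : Convex ℝ s) {d : ℝ≥0∞} (hd : ∀ x ∈ s, ∀ y ∈ s, ‖y - x‖ₑ ≤ d)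
    {p : ℝ} (hp : 1 ≤ p) :
    ∫⁻ x in s, ∫⁻ y in s, ‖v y - v x‖ₑ ^ p ∂μ ∂μ
      ≤ d ^ p * (2 ^ Module.finrank ℝ E * μ s) * ∫⁻ x in s, ‖fderiv ℝ v x‖ₑ ^ p ∂μ := by
  have hp0 : 0 ≤ p := by linarith
  have hcont : Continuous (fderiv ℝ v) := hv.continuous_fderiv one_ne_zero
  set g : E → ℝ≥0∞ := fun x ↦ ‖fderiv ℝ v x‖ₑ ^ p with hg
  have hgm : Measurable g := (by fun_prop : Measurable fun x ↦ ‖fderiv ℝ v x‖ₑ).pow_const p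
  have hpt : ∀ x ∈ s, ∀ y ∈ s, ‖v y - v x‖ₑ ^ p
      ≤ d ^ p * ∫⁻ t in Set.Icc (0 : ℝ) 1, g (x + t • (y - x)) := by
    intro x hx y hy
    have hm : Measurable fun t : ℝ ↦ ‖fderiv ℝ v (x + t • (y - x))‖ₑ := by fun_prop
    calc ‖v y - v x‖ₑ ^ p
        ≤ (∫⁻ t in Set.Icc (0 : ℝ) 1, ‖fderiv ℝ v (x + t • (y - x))‖ₑ * d) ^ p := by
          gcongr
          refine (enorm_sub_le_lintegral_fderiv_segment hv x y).trans (lintegral_mono fun t ↦ ?_)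
          gcongr
          exact hd x hx y hy
      _ = d ^ p * (∫⁻ t in Set.Icc (0 : ℝ) 1, ‖fderiv ℝ v (x + t • (y - x))‖ₑ) ^ p := by
          rw [lintegral_mul_const _ hm, ENNReal.mul_rpow_of_nonneg _ _ hp0, mul_comm]
      _ ≤ _ := by
          gcongr
          simpa using ENNReal.rpow_lintegral_le (ν := volume.restrict (Set.Icc (0 : ℝ) 1)) hm hp
  calc ∫⁻ x in s, ∫⁻ y in s, ‖v y - v x‖ₑ ^ p ∂μ ∂μ
      ≤ ∫⁻ x in s, ∫⁻ y in s,
          (d ^ p * ∫⁻ t in Set.Icc (0 : ℝ) 1, g (x + t • (y - x))) ∂μ ∂μ :=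
        setLIntegral_mono' hs fun x hx ↦ setLIntegral_mono' hs fun y hy ↦ hpt x hx y hy
    _ = d ^ p * ∫⁻ x in s, ∫⁻ y in s, (∫⁻ t in Set.Icc (0 : ℝ) 1, g (x + t • (y - x))) ∂μ ∂μ := by
        have h1 : Measurable fun z : E × E ↦ ∫⁻ t in Set.Icc (0 : ℝ) 1, g (z.1 + t • (z.2 - z.1)) :=
          Measurable.lintegral_prod_right'
            (f := fun w : (E × E) × ℝ ↦ g (w.1.1 + w.2 • (w.1.2 - w.1.1))) (by fun_prop)
        rw [← lintegral_const_mul _ h1.lintegral_prod_right']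
        refine lintegral_congr fun x ↦ ?_
        rw [← lintegral_const_mul _ (by fun_prop)]
    _ = d ^ p * ∫⁻ t in Set.Icc (0 : ℝ) 1, ∫⁻ x in s, ∫⁻ y in s, g (x + t • (y - x)) ∂μ ∂μ := by
        congr 1
        have h2 : Measurable fun w : E × ℝ ↦ ∫⁻ y in s, g (w.1 + w.2 • (y - w.1)) ∂μ :=
          Measurable.lintegral_prod_right'
            (f := fun w : (E × ℝ) × E ↦ g (w.1.1 + w.1.2 • (w.2 - w.1.1))) (by fun_prop)
        refine (lintegral_congr fun x ↦ ?_).trans (lintegral_lintegral_swap h2.aemeasurable)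
        rw [lintegral_lintegral_swap (Measurable.aemeasurable (by fun_prop))]
    _ ≤ d ^ p * ∫⁻ t in Set.Icc (0 : ℝ) 1, 2 ^ Module.finrank ℝ E * μ s * ∫⁻ x in s, g x ∂μ := by
        refine mul_le_mul' le_rfl ?_
        exact setLIntegral_mono' measurableSet_Icc fun t ht ↦
          lintegral_lintegral_segment_le μ hgm hs hconv ht
    _ = _ := by simp [mul_assoc]

/-- The `L^p` Poincaré inequality on a bounded convex set `s`, with the average over a
subset `A`. -/
lemma eLpNorm_le_eLpNorm_fderiv_add_average {v : E → ℝ} (hv : ContDiff ℝ 1 v) {s A : Set E}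
    (hs : MeasurableSet s) (hconv : Convex ℝ s) {d : ℝ≥0∞} (hd : ∀ x ∈ s, ∀ y ∈ s, ‖y - x‖ₑ ≤ d)
    (hAs : A ⊆ s) (hA0 : μ A ≠ 0) (hAtop : μ A ≠ ∞) {p : ℝ} (hp : 1 ≤ p) :
    eLpNorm v (ENNReal.ofReal p) (μ.restrict s)
      ≤ ((μ A)⁻¹ * (d ^ p * (2 ^ Module.finrank ℝ E * μ s))) ^ (1 / p)
          * eLpNorm (fderiv ℝ v) (ENNReal.ofReal p) (μ.restrict s)
        + μ s ^ (1 / p) * ((μ A)⁻¹ * ∫⁻ y in A, ‖v y‖ₑ ∂μ) := by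
  have hp0 : 0 < p := by linarith
  have hpe : ENNReal.ofReal p ≠ 0 := by simpa using hp0
  have hcont : Continuous v := hv.continuous
  set N := ∫⁻ y in A, ‖v y‖ₑ ∂μ
  set G := ∫⁻ x in s, ‖fderiv ℝ v x‖ₑ ^ p ∂μ with hG
  set K := d ^ p * (2 ^ Module.finrank ℝ E * μ s)
  set φ : E → ℝ≥0∞ := fun x ↦ ∫⁻ y in A, ‖v y - v x‖ₑ ∂μ with hφ
  have hφm : Measurable φ :=
    Measurable.lintegral_prod_right' (f := fun w : E × E ↦ ‖v w.2 - v w.1‖ₑ) (by fun_prop)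
  have hpt : ∀ x, μ A * ‖v x‖ₑ ≤ φ x + N := by
    intro x
    rw [hφ, ← lintegral_add_right _ (by fun_prop), mul_comm, ← setLIntegral_const]
    refine lintegral_mono fun y ↦ ?_
    calc ‖v x‖ₑ = ‖(v y) - (v y - v x)‖ₑ := by simp
      _ ≤ ‖v y‖ₑ + ‖v y - v x‖ₑ := enorm_sub_le
      _ = _ := add_comm _ _
  have hφp : ∫⁻ x in s, φ x ^ p ∂μ ≤ μ A ^ (p - 1) * (K * G) := by
    calc ∫⁻ x in s, φ x ^ p ∂μ
        ≤ ∫⁻ x in s, (∫⁻ y in s, ‖v y - v x‖ₑ ^ p ∂μ) * μ A ^ (p - 1) ∂μ := by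
          refine lintegral_mono fun x ↦ ?_
          have h := ENNReal.rpow_lintegral_le (ν := μ.restrict A)
            (f := fun y ↦ ‖v y - v x‖ₑ) (by fun_prop) hp
          rw [Measure.restrict_apply_univ] at h
          refine h.trans ?_
          gcongr
      _ ≤ _ := by
          rw [lintegral_mul_const', mul_comm]
          · gcongr
            exact lintegral_lintegral_enorm_sub_rpow_le μ hv hs hconv hd hp
          · exact ENNReal.rpow_ne_top_of_nonneg (by linarith) hAtop
  have hmain : μ A * (∫⁻ x in s, ‖v x‖ₑ ^ p ∂μ) ^ (1 / p)
      ≤ (μ A ^ (p - 1) * (K * G)) ^ (1 / p) + μ s ^ (1 / p) * N := by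
    calc μ A * (∫⁻ x in s, ‖v x‖ₑ ^ p ∂μ) ^ (1 / p)
        = (∫⁻ x in s, (μ A * ‖v x‖ₑ) ^ p ∂μ) ^ (1 / p) := by
          simp_rw [ENNReal.mul_rpow_of_nonneg _ _ hp0.le]
          rw [lintegral_const_mul' _ _ (ENNReal.rpow_ne_top_of_nonneg hp0.le hAtop),
            ENNReal.mul_rpow_of_nonneg _ _ (by positivity), ← ENNReal.rpow_mul,
            mul_one_div_cancel hp0.ne', ENNReal.rpow_one]
      _ ≤ (∫⁻ x in s, (φ x + N) ^ p ∂μ) ^ (1 / p) := by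
          gcongr with x
          exact hpt x
      _ ≤ (∫⁻ x in s, φ x ^ p ∂μ) ^ (1 / p) + (∫⁻ x in s, N ^ p ∂μ) ^ (1 / p) :=
          ENNReal.lintegral_Lp_add_le hφm.aemeasurable aemeasurable_const hp
      _ ≤ _ := by
          gcongr
          rw [setLIntegral_const, ENNReal.mul_rpow_of_nonneg _ _ (by positivity),
            ← ENNReal.rpow_mul, mul_one_div_cancel hp0.ne', ENNReal.rpow_one, mul_comm]
  rw [eLpNorm_eq_lintegral_rpow_enorm_toReal hpe ENNReal.ofReal_ne_top,
    eLpNorm_eq_lintegral_rpow_enorm_toReal hpe ENNReal.ofReal_ne_top,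
    ENNReal.toReal_ofReal hp0.le, ← hG]
  calc (∫⁻ x in s, ‖v x‖ₑ ^ p ∂μ) ^ (1 / p)
      = (μ A)⁻¹ * (μ A * (∫⁻ x in s, ‖v x‖ₑ ^ p ∂μ) ^ (1 / p)) := by
        rw [← mul_assoc, ENNReal.inv_mul_cancel hA0 hAtop, one_mul]
    _ ≤ (μ A)⁻¹ * ((μ A ^ (p - 1) * (K * G)) ^ (1 / p) + μ s ^ (1 / p) * N) := by gcongr
    _ = _ := by
        rw [mul_add]
        congr 1
        · have h1 : (μ A)⁻¹ = ((μ A) ^ (-p)) ^ (1 / p) := by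
            rw [← ENNReal.rpow_mul, neg_mul, mul_one_div_cancel hp0.ne', ENNReal.rpow_neg_one]
          rw [h1, ← ENNReal.mul_rpow_of_nonneg _ _ (by positivity),
            ← ENNReal.mul_rpow_of_nonneg _ _ (by positivity), ← h1, ← mul_assoc, ← mul_assoc,
            ← ENNReal.rpow_add _ _ hA0 hAtop, ← ENNReal.rpow_neg_one]
          congr 4
          ring
        · ring

end Poincare

section Gluing

variable {E F : Type*} [NormedAddCommGroup E] [NormedSpace ℝ E] [NormedAddCommGroup F]
  [NormedSpace ℝ F]

lemma hasFDerivAt_ite_norm_le_one {f g : E → F} (hf : Differentiable ℝ f)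
    (hg : ∀ x, 1 ≤ ‖x‖ → DifferentiableAt ℝ g x) (h0 : ∀ x, ‖x‖ = 1 → f x = g x)
    (h1 : ∀ x, ‖x‖ = 1 → fderiv ℝ f x = fderiv ℝ g x) (x : E) :
    HasFDerivAt (fun x ↦ if ‖x‖ ≤ 1 then f x else g x)
      (if ‖x‖ ≤ 1 then fderiv ℝ f x else fderiv ℝ g x) x := by
  rcases lt_trichotomy ‖x‖ 1 with hx | hx | hx
  · rw [if_pos hx.le]
    refine (hf x).hasFDerivAt.congr_of_eventuallyEq ?_
    filter_upwards [continuous_norm.continuousAt.eventually_lt continuousAt_const hx] with y hy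
    rw [if_pos hy.le]
  · have hF : HasFDerivWithinAt (fun x ↦ if ‖x‖ ≤ 1 then f x else g x) (fderiv ℝ f x)
        {y | ‖y‖ ≤ 1} x :=
      (hf x).hasFDerivAt.hasFDerivWithinAt.congr (fun y hy ↦ if_pos hy) (if_pos hx.le)
    have hG : HasFDerivWithinAt (fun x ↦ if ‖x‖ ≤ 1 then f x else g x) (fderiv ℝ f x)
        {y | 1 ≤ ‖y‖} x := by
      have hite : ∀ y : E, 1 ≤ ‖y‖ → (if ‖y‖ ≤ 1 then f y else g y) = g y := by
        intro y hy
        split_ifs with h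
        · exact h0 y (le_antisymm h hy)
        · rfl
      rw [h1 x hx]
      exact (hg x hx.ge).hasFDerivAt.hasFDerivWithinAt.congr hite (hite x hx.ge)
    rw [if_pos hx.le]
    refine (hF.union hG).hasFDerivAt (Filter.univ_mem' fun y ↦ ?_)
    exact le_total ‖y‖ 1
  · rw [if_neg hx.not_ge]
    refine (hg x hx.le).hasFDerivAt.congr_of_eventuallyEq ?_
    filter_upwards [continuousAt_const.eventually_lt continuous_norm.continuousAt hx] with y hy
    rw [if_neg hy.not_ge]

lemma contDiff_ite_norm_le_one {f g : E → F} (hf : ContDiff ℝ 1 f)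
    (hg : ∀ x, 1 ≤ ‖x‖ → ContDiffAt ℝ 1 g x) (h0 : ∀ x, ‖x‖ = 1 → f x = g x)
    (h1 : ∀ x, ‖x‖ = 1 → fderiv ℝ f x = fderiv ℝ g x) :
    ContDiff ℝ 1 (fun x ↦ if ‖x‖ ≤ 1 then f x else g x) := by
  refine contDiff_one_iff_hasFDerivAt.2 ⟨_, ?_, hasFDerivAt_ite_norm_le_one
    (hf.differentiable one_ne_zero) (fun x hx ↦ (hg x hx).differentiableAt one_ne_zero) h0 h1⟩
  refine continuous_if_le continuous_norm continuous_const
    (hf.continuous_fderiv one_ne_zero).continuousOn (fun x hx ↦ ?_) h1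
  exact ((hg x hx).continuousAt_fderiv one_ne_zero).continuousWithinAt

end Gluing

section RadialPower

variable {E : Type*} [NormedAddCommGroup E] [InnerProductSpace ℝ E]

/-- The radial map `x ↦ ‖x‖ ^ (2 * a) • x`. -/
noncomputable def radialPow (a : ℝ) (x : E) : E := (‖x‖ ^ 2) ^ a • x

lemma norm_radialPow (a : ℝ) {x : E} (hx : x ≠ 0) : ‖radialPow a x‖ = ‖x‖ ^ (2 * a + 1) := by
  have hx' : 0 < ‖x‖ := norm_pos_iff.2 hx
  rw [radialPow, norm_smul, Real.norm_of_nonneg (by positivity), Real.rpow_add hx', Real.rpow_one,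
    Real.rpow_mul hx'.le, Real.rpow_two]

lemma radialPow_of_norm_eq_one (a : ℝ) {x : E} (hx : ‖x‖ = 1) : radialPow a x = x := by
  simp [radialPow, hx]

lemma radialPow_radialPow {a b : ℝ} (hab : b * (2 * a + 1) + a = 0) {x : E} (hx : x ≠ 0) :
    radialPow b (radialPow a x) = x := by
  have hx' : 0 < ‖x‖ := norm_pos_iff.2 hx
  rw [radialPow, norm_radialPow a hx, radialPow, smul_smul, ← Real.rpow_two, ← Real.rpow_two,
    ← Real.rpow_mul hx'.le, ← Real.rpow_mul hx'.le, ← Real.rpow_mul hx'.le, ← Real.rpow_add hx',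
    show (2 * a + 1) * 2 * b + 2 * a = 2 * (b * (2 * a + 1) + a) by ring, hab]
  simp

lemma contDiffAt_radialPow (a : ℝ) {x : E} (hx : x ≠ 0) : ContDiffAt ℝ 1 (radialPow a) x :=
  ((contDiffAt_id.norm_sq ℝ).rpow_const_of_ne (by simpa using hx)).smul contDiffAt_id

lemma hasFDerivAt_radialPow (a : ℝ) {x : E} (hx : ‖x‖ = 1) :
    HasFDerivAt (radialPow a)
      (ContinuousLinearMap.id ℝ E + (2 * a) • (innerSL ℝ x).smulRight x) x := by
  have h := ((hasStrictFDerivAt_norm_sq x).hasFDerivAt.rpow_const (p := a)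
    (Or.inl (by simp [hx]))).smul (hasFDerivAt_id x)
  refine h.congr_fderiv ?_
  ext y
  simp [hx]
  module

end RadialPower

section RadialMeasure

variable {E : Type*} [NormedAddCommGroup E] [InnerProductSpace ℝ E] [FiniteDimensional ℝ E]

lemma isCompact_annulus (r R : ℝ) : IsCompact {x : E | r ≤ ‖x‖ ∧ ‖x‖ ≤ R} := by
  refine (isCompact_closedBall (0 : E) R).of_isClosed_subset ?_ fun x hx ↦ by simpa using hx.2
  exact (isClosed_le continuous_const continuous_norm).inter
    (isClosed_le continuous_norm continuous_const)

lemma exists_norm_fderiv_radialPow_le (a : ℝ) {r : ℝ} (hr : 0 < r) (R : ℝ) :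
    ∃ L : ℝ, ∀ x : E, r ≤ ‖x‖ → ‖x‖ ≤ R → ‖fderiv ℝ (radialPow a) x‖ ≤ L := by
  obtain ⟨L, hL⟩ := (isCompact_annulus (E := E) r R).exists_bound_of_continuousOn
    (f := fderiv ℝ (radialPow a)) fun x hx ↦
      ((contDiffAt_radialPow a (norm_pos_iff.1 (hr.trans_le hx.1))).continuousAt_fderiv
        one_ne_zero).continuousWithinAt
  exact ⟨L, fun x h1 h2 ↦ hL x ⟨h1, h2⟩⟩

variable [MeasurableSpace E] [BorelSpace E] (μ : Measure E) [μ.IsAddHaarMeasure]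

lemma measurable_radialPow (a : ℝ) : Measurable (radialPow a : E → E) := by
  unfold radialPow
  fun_prop

lemma exists_map_radialPow_le {a : ℝ} (ha : 2 * a + 1 < 0) :
    ∃ K : ℝ≥0, (μ.restrict {x : E | 1 ≤ ‖x‖ ∧ ‖x‖ ≤ 2}).map (radialPow a)
      ≤ (K : ℝ≥0∞) • μ.restrict (Metric.closedBall 0 1) := by
  set b : ℝ := -a / (2 * a + 1)
  have hab : b * (2 * a + 1) + a = 0 := by
    rw [div_mul_cancel₀ _ ha.ne, neg_add_cancel]
  set r : ℝ := 2 ^ (2 * a + 1)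
  have hr : 0 < r := by positivity
  set N' := {x : E | r ≤ ‖x‖ ∧ ‖x‖ ≤ 1}
  have hN' : IsCompact N' := isCompact_annulus r 1
  have hne : ∀ x ∈ N', x ≠ 0 := fun x hx ↦ norm_pos_iff.1 (hr.trans_le hx.1)
  obtain ⟨K, hK⟩ := hN'.exists_bound_of_continuousOn
    (f := fun x ↦ (fderiv ℝ (radialPow b : E → E) x).det) fun x hx ↦
      (ContinuousLinearMap.continuous_det.continuousAt.comp
        ((contDiffAt_radialPow b (hne x hx)).continuousAt_fderiv
          one_ne_zero)).continuousWithinAt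
  refine ⟨K.toNNReal, Measure.le_iff.2 fun T hT ↦ ?_⟩
  rw [Measure.map_apply (measurable_radialPow a) hT, Measure.smul_apply, Measure.restrict_apply hT,
    Measure.restrict_apply (measurable_radialPow a hT), smul_eq_mul]
  have hsub : radialPow a ⁻¹' T ∩ {x : E | 1 ≤ ‖x‖ ∧ ‖x‖ ≤ 2} ⊆ radialPow b '' (T ∩ N') := by
    rintro x ⟨hxT, hx1, hx2⟩
    have hx0 : 0 < ‖x‖ := by linarith
    have hx : x ≠ 0 := norm_pos_iff.1 hx0
    refine ⟨radialPow a x, ⟨hxT, ?_, ?_⟩, radialPow_radialPow hab hx⟩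
    · rw [norm_radialPow a hx]
      exact Real.rpow_le_rpow_of_nonpos hx0 hx2 ha.le
    · rw [norm_radialPow a hx]
      exact Real.rpow_le_one_of_one_le_of_nonpos hx1 ha.le
  calc μ (radialPow a ⁻¹' T ∩ {x : E | 1 ≤ ‖x‖ ∧ ‖x‖ ≤ 2})
      ≤ μ (radialPow b '' (T ∩ N')) := measure_mono hsub
    _ ≤ ∫⁻ x in T ∩ N', ENNReal.ofReal |(fderiv ℝ (radialPow b : E → E) x).det| ∂μ :=
        addHaar_image_le_lintegral_abs_det_fderiv μ (hT.inter hN'.measurableSet) fun x hx ↦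
          ((contDiffAt_radialPow b (hne x hx.2)).differentiableAt
            one_ne_zero).hasFDerivAt.hasFDerivWithinAt
    _ ≤ ∫⁻ _ in T ∩ N', ENNReal.ofReal K ∂μ :=
        setLIntegral_mono' (hT.inter hN'.measurableSet) fun x hx ↦
          ENNReal.ofReal_le_ofReal (hK x hx.2)
    _ = ENNReal.ofReal K * μ (T ∩ N') := setLIntegral_const _ _
    _ ≤ _ := by
        gcongr
        · exact le_rfl
        · exact fun x hx ↦ by simpa using hx.2

lemma exists_eLpNorm_comp_radialPow_le {a : ℝ} (ha : 2 * a + 1 < 0) {p : ℝ≥0∞} (hp : p ≠ ∞) :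
    ∃ K : ℝ≥0, ∀ f : E → ℝ, Continuous f →
      eLpNorm (f ∘ radialPow a) p (μ.restrict {x : E | 1 ≤ ‖x‖ ∧ ‖x‖ ≤ 2})
        ≤ K * eLpNorm f p (μ.restrict (Metric.closedBall 0 1)) := by
  obtain ⟨K, hK⟩ := exists_map_radialPow_le μ ha
  refine ⟨K ^ (1 / p).toReal, fun f hf ↦ ?_⟩
  rw [← eLpNorm_map_measure hf.aestronglyMeasurable (measurable_radialPow a).aemeasurable]
  refine (eLpNorm_mono_measure f hK).trans ?_
  rw [eLpNorm_smul_measure_of_ne_top hp, smul_eq_mul, ENNReal.coe_rpow_of_nonneg _ (by positivity)]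

end RadialMeasure

section Extension

variable {E : Type*} [NormedAddCommGroup E] [InnerProductSpace ℝ E]

/-- The `C¹` extension of `v` from the closed unit ball by a combination of two radial
reflections, chosen so that values and derivatives match on the unit sphere. -/
noncomputable def radialExtension (v : E → ℝ) (x : E) : ℝ :=
  if ‖x‖ ≤ 1 then v x else 3 * v (radialPow (-1) x) - 2 * v (radialPow (-3 / 2) x)

lemma hasFDerivAt_comp_radialPow {v : E → ℝ} (hv : Differentiable ℝ v) (a : ℝ) {x : E}
    (hx : x ≠ 0) :
    HasFDerivAt (fun x ↦ v (radialPow a x))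
      ((fderiv ℝ v (radialPow a x)).comp (fderiv ℝ (radialPow a) x)) x :=
  (hv _).hasFDerivAt.comp x ((contDiffAt_radialPow a hx).differentiableAt one_ne_zero).hasFDerivAt

lemma hasFDerivAt_reflection {v : E → ℝ} (hv : Differentiable ℝ v) {x : E} (hx : x ≠ 0) :
    HasFDerivAt (fun x ↦ 3 * v (radialPow (-1) x) - 2 * v (radialPow (-3 / 2) x))
      ((3 : ℝ) • (fderiv ℝ v (radialPow (-1) x)).comp (fderiv ℝ (radialPow (-1)) x)
        - (2 : ℝ) • (fderiv ℝ v (radialPow (-3 / 2) x)).comp (fderiv ℝ (radialPow (-3 / 2)) x)) x :=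
  ((hasFDerivAt_comp_radialPow hv _ hx).const_mul 3).sub
    ((hasFDerivAt_comp_radialPow hv _ hx).const_mul 2)

lemma fderiv_reflection_of_norm_eq_one {v : E → ℝ} (hv : Differentiable ℝ v) {x : E}
    (hx : ‖x‖ = 1) :
    fderiv ℝ v x
      = fderiv ℝ (fun x ↦ 3 * v (radialPow (-1) x) - 2 * v (radialPow (-3 / 2) x)) x := by
  have hx0 : x ≠ 0 := norm_ne_zero_iff.1 (by simp [hx])
  rw [(hasFDerivAt_reflection hv hx0).fderiv, (hasFDerivAt_radialPow _ hx).fderiv,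
    (hasFDerivAt_radialPow _ hx).fderiv, radialPow_of_norm_eq_one _ hx,
    radialPow_of_norm_eq_one _ hx]
  ext y
  simp
  ring

lemma contDiffAt_reflection {v : E → ℝ} (hv : ContDiff ℝ 1 v) {x : E} (hx : x ≠ 0) :
    ContDiffAt ℝ 1 (fun x ↦ 3 * v (radialPow (-1) x) - 2 * v (radialPow (-3 / 2) x)) x := by
  have h : ∀ a : ℝ, ContDiffAt ℝ 1 (fun x ↦ v (radialPow a x)) x := fun a ↦
    hv.contDiffAt.comp x (contDiffAt_radialPow a hx)
  exact (contDiffAt_const.mul (h _)).sub (contDiffAt_const.mul (h _))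

lemma value_reflection_of_norm_eq_one (v : E → ℝ) {x : E} (hx : ‖x‖ = 1) :
    v x = 3 * v (radialPow (-1) x) - 2 * v (radialPow (-3 / 2) x) := by
  rw [radialPow_of_norm_eq_one _ hx, radialPow_of_norm_eq_one _ hx]
  ring

omit [InnerProductSpace ℝ E] in
lemma ne_zero_of_one_le_norm {x : E} (hx : 1 ≤ ‖x‖) : x ≠ 0 :=
  norm_pos_iff.1 (one_pos.trans_le hx)

lemma contDiff_radialExtension {v : E → ℝ} (hv : ContDiff ℝ 1 v) :
    ContDiff ℝ 1 (radialExtension v) :=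
  contDiff_ite_norm_le_one hv (fun _ hx ↦ contDiffAt_reflection hv (ne_zero_of_one_le_norm hx))
    (fun _ hx ↦ value_reflection_of_norm_eq_one v hx)
    fun _ hx ↦ fderiv_reflection_of_norm_eq_one (hv.differentiable one_ne_zero) hx

lemma fderiv_radialExtension {v : E → ℝ} (hv : ContDiff ℝ 1 v) (x : E) :
    fderiv ℝ (radialExtension v) x = if ‖x‖ ≤ 1 then fderiv ℝ v x else
      fderiv ℝ (fun x ↦ 3 * v (radialPow (-1) x) - 2 * v (radialPow (-3 / 2) x)) x :=
  (hasFDerivAt_ite_norm_le_one (hv.differentiable one_ne_zero)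
    (fun _ hx ↦ (contDiffAt_reflection hv (ne_zero_of_one_le_norm hx)).differentiableAt one_ne_zero)
    (fun _ hx ↦ value_reflection_of_norm_eq_one v hx)
    (fun _ hx ↦ fderiv_reflection_of_norm_eq_one (hv.differentiable one_ne_zero) hx) x).fderiv

lemma abs_radialExtension_le (v : E → ℝ) {x : E} (hx : 1 < ‖x‖) :
    |radialExtension v x| ≤ 3 * (|v (radialPow (-1) x)| + |v (radialPow (-3 / 2) x)|) := by
  rw [radialExtension, if_neg hx.not_ge]
  refine (abs_sub _ _).trans ?_
  rw [abs_mul, abs_mul, abs_two, abs_of_pos (three_pos : (0 : ℝ) < 3)]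
  linarith [abs_nonneg (v (radialPow (-3 / 2) x))]

variable [FiniteDimensional ℝ E]

lemma exists_norm_fderiv_radialExtension_le :
    ∃ c : ℝ≥0, ∀ v : E → ℝ, ContDiff ℝ 1 v → ∀ x : E, 1 < ‖x‖ → ‖x‖ ≤ 2 →
      ‖fderiv ℝ (radialExtension v) x‖
        ≤ c * (‖fderiv ℝ v (radialPow (-1) x)‖ + ‖fderiv ℝ v (radialPow (-3 / 2) x)‖) := by
  obtain ⟨L₁, h₁⟩ := exists_norm_fderiv_radialPow_le (E := E) (-1) one_pos 2
  obtain ⟨L₂, h₂⟩ := exists_norm_fderiv_radialPow_le (E := E) (-3 / 2) one_pos 2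
  set L : ℝ := max (max L₁ L₂) 0
  refine ⟨⟨3 * L, by positivity⟩, fun v hv x hx1 hx2 ↦ ?_⟩
  have hL : 0 ≤ L := le_max_right _ _
  have hL₁ : ‖fderiv ℝ (radialPow (-1)) x‖ ≤ L :=
    (h₁ x hx1.le hx2).trans ((le_max_left _ _).trans (le_max_left _ _))
  have hL₂ : ‖fderiv ℝ (radialPow (-3 / 2)) x‖ ≤ L :=
    (h₂ x hx1.le hx2).trans ((le_max_right _ _).trans (le_max_left _ _))
  rw [fderiv_radialExtension hv, if_neg hx1.not_ge, (hasFDerivAt_reflection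
    (hv.differentiable one_ne_zero) (ne_zero_of_one_le_norm hx1.le)).fderiv]
  set D₁ := fderiv ℝ v (radialPow (-1) x)
  set D₂ := fderiv ℝ v (radialPow (-3 / 2) x)
  calc _ ≤ 3 * ‖D₁.comp (fderiv ℝ (radialPow (-1)) x)‖
          + 2 * ‖D₂.comp (fderiv ℝ (radialPow (-3 / 2)) x)‖ := by
        refine (norm_sub_le _ _).trans_eq ?_
        rw [norm_smul, norm_smul]
        norm_num
    _ ≤ 3 * (‖D₁‖ * L) + 2 * (‖D₂‖ * L) := by
        gcongr
        · exact (ContinuousLinearMap.opNorm_comp_le _ _).trans (by gcongr)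
        · exact (ContinuousLinearMap.opNorm_comp_le _ _).trans (by gcongr)
    _ ≤ 3 * L * (‖D₁‖ + ‖D₂‖) := by nlinarith [mul_nonneg (norm_nonneg D₂) hL]

variable [MeasurableSpace E] [BorelSpace E] (μ : Measure E) [μ.IsAddHaarMeasure]

lemma exists_eLpNorm_closedBall_two_le {p : ℝ≥0∞} (hp1 : 1 ≤ p) (hp : p ≠ ∞) (c : ℝ≥0) :
    ∃ K : ℝ≥0, ∀ f g : E → ℝ, Continuous f → (∀ x, ‖x‖ ≤ 1 → ‖g x‖ ≤ ‖f x‖) →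
      (∀ x, 1 < ‖x‖ → ‖x‖ ≤ 2 →
        ‖g x‖ ≤ c * (‖f (radialPow (-1) x)‖ + ‖f (radialPow (-3 / 2) x)‖)) →
      eLpNorm g p (μ.restrict (Metric.closedBall 0 2))
        ≤ K * eLpNorm f p (μ.restrict (Metric.closedBall 0 1)) := by
  obtain ⟨K₁, hK₁⟩ := exists_eLpNorm_comp_radialPow_le μ (a := -1) (by norm_num) hp
  obtain ⟨K₂, hK₂⟩ := exists_eLpNorm_comp_radialPow_le μ (a := -3 / 2) (by norm_num) hp
  refine ⟨1 + c * (K₁ + K₂), fun f g hf hg1 hg2 ↦ ?_⟩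
  set N := {x : E | 1 ≤ ‖x‖ ∧ ‖x‖ ≤ 2}
  have hN : MeasurableSet N := (isCompact_annulus 1 2).measurableSet
  set f₁ : E → ℝ := fun x ↦ ‖f (radialPow (-1) x)‖
  set f₂ : E → ℝ := fun x ↦ ‖f (radialPow (-3 / 2) x)‖
  have hf₁ : Measurable f₁ := (hf.measurable.comp (measurable_radialPow _)).norm
  have hf₂ : Measurable f₂ := (hf.measurable.comp (measurable_radialPow _)).norm
  set b₁ : E → ℝ := (Metric.closedBall 0 1).indicator f
  set b₂ : E → ℝ := N.indicator ((c : ℝ) • (f₁ + f₂))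
  have hb₁ : Measurable b₁ := hf.measurable.indicator Metric.isClosed_closedBall.measurableSet
  have hb₂ : Measurable b₂ := ((hf₁.add hf₂).const_smul _).indicator hN
  have hpt : ∀ x, ‖(Metric.closedBall 0 2).indicator g x‖ ≤ ‖b₁ x‖ + ‖b₂ x‖ := by
    intro x
    by_cases hx2 : ‖x‖ ≤ 2
    · rw [Set.indicator_of_mem (by simpa using hx2)]
      rcases le_or_gt ‖x‖ 1 with hx1 | hx1
      · have : b₁ x = f x := Set.indicator_of_mem (by simpa using hx1) _
        rw [this]
        linarith [hg1 x hx1, norm_nonneg (b₂ x)]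
      · have : b₂ x = c * (f₁ x + f₂ x) := Set.indicator_of_mem (show x ∈ N from ⟨hx1.le, hx2⟩) _
        rw [this]
        exact ((hg2 x hx1 hx2).trans (le_abs_self _)).trans (le_add_of_nonneg_left (norm_nonneg _))
    · rw [Set.indicator_of_notMem (by simpa using hx2), norm_zero]
      positivity
  calc eLpNorm g p (μ.restrict (Metric.closedBall 0 2))
      = eLpNorm ((Metric.closedBall 0 2).indicator g) p μ :=
        (eLpNorm_indicator_eq_eLpNorm_restrict Metric.isClosed_closedBall.measurableSet).symm
    _ ≤ eLpNorm ((fun x ↦ ‖b₁ x‖) + fun x ↦ ‖b₂ x‖) p μ := eLpNorm_mono_real hpt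
    _ ≤ eLpNorm (fun x ↦ ‖b₁ x‖) p μ + eLpNorm (fun x ↦ ‖b₂ x‖) p μ :=
        eLpNorm_add_le hb₁.norm.aestronglyMeasurable hb₂.norm.aestronglyMeasurable hp1
    _ = eLpNorm f p (μ.restrict (Metric.closedBall 0 1))
          + eLpNorm ((c : ℝ) • (f₁ + f₂)) p (μ.restrict N) := by
        rw [eLpNorm_norm, eLpNorm_norm, eLpNorm_indicator_eq_eLpNorm_restrict hN,
          eLpNorm_indicator_eq_eLpNorm_restrict Metric.isClosed_closedBall.measurableSet]
    _ ≤ eLpNorm f p (μ.restrict (Metric.closedBall 0 1))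
          + c * (K₁ * eLpNorm f p (μ.restrict (Metric.closedBall 0 1))
            + K₂ * eLpNorm f p (μ.restrict (Metric.closedBall 0 1))) := by
        gcongr
        refine eLpNorm_const_smul_le.trans ?_
        rw [Real.enorm_of_nonneg c.coe_nonneg, ENNReal.ofReal_coe_nnreal]
        gcongr
        refine (eLpNorm_add_le hf₁.aestronglyMeasurable hf₂.aestronglyMeasurable hp1).trans ?_
        simp only [f₁, f₂, eLpNorm_norm]
        exact add_le_add (hK₁ f hf) (hK₂ f hf)
    _ = _ := by
        push_cast
        ring

omit [MeasurableSpace E] [BorelSpace E] in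
lemma ContDiffBump.exists_norm_fderiv_mul_le (χ : ContDiffBump (0 : E)) :
    ∃ M : ℝ≥0, ∀ w : E → ℝ, Differentiable ℝ w → ∀ x,
      ‖fderiv ℝ (fun x ↦ χ x * w x) x‖ ≤ M * (‖w x‖ + ‖fderiv ℝ w x‖) := by
  have hχ : ContDiff ℝ 1 χ := χ.contDiff
  obtain ⟨M₀, hM₀⟩ := (χ.hasCompactSupport.fderiv ℝ).exists_bound_of_continuous
    (hχ.continuous_fderiv one_ne_zero)
  refine ⟨max M₀.toNNReal 1, fun w hw x ↦ ?_⟩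
  set M : ℝ≥0 := max M₀.toNNReal 1
  have hM : ‖fderiv ℝ χ x‖ ≤ M :=
    (hM₀ x).trans ((Real.le_coe_toNNReal _).trans (NNReal.coe_le_coe.2 (le_max_left _ _)))
  have hM1 : (1 : ℝ) ≤ M := NNReal.coe_le_coe.2 (le_max_right M₀.toNNReal 1)
  rw [((hχ.differentiable one_ne_zero x).hasFDerivAt.fun_mul (hw x).hasFDerivAt).fderiv]
  refine (norm_add_le _ _).trans ?_
  rw [norm_smul, norm_smul, Real.norm_of_nonneg χ.nonneg]
  calc χ x * ‖fderiv ℝ w x‖ + ‖w x‖ * ‖fderiv ℝ χ x‖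
      ≤ M * ‖fderiv ℝ w x‖ + ‖w x‖ * M := by
        gcongr
        exact χ.le_one.trans hM1
    _ = _ := by ring

/-- Every `C¹` function can be cut off and extended from the unit ball to a `C¹` function
supported in the ball of radius `2`, with control on the `L^p` norm of the derivative. -/
lemma exists_contDiff_extension {p : ℝ≥0∞} (hp1 : 1 ≤ p) (hp : p ≠ ∞) :
    ∃ K : ℝ≥0, ∀ v : E → ℝ, ContDiff ℝ 1 v → ∃ u : E → ℝ, ContDiff ℝ 1 u ∧
      u.support ⊆ Metric.closedBall 0 2 ∧ (∀ x, ‖x‖ ≤ 1 → u x = v x) ∧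
      eLpNorm (fderiv ℝ u) p μ ≤ K * (eLpNorm v p (μ.restrict (Metric.closedBall 0 1))
        + eLpNorm (fderiv ℝ v) p (μ.restrict (Metric.closedBall 0 1))) := by
  obtain ⟨c, hc⟩ := exists_norm_fderiv_radialExtension_le (E := E)
  obtain ⟨K₀, hK₀⟩ := exists_eLpNorm_closedBall_two_le μ hp1 hp 3
  obtain ⟨K₁, hK₁⟩ := exists_eLpNorm_closedBall_two_le μ hp1 hp c
  obtain ⟨χ, hin, hout⟩ : ∃ χ : ContDiffBump (0 : E), χ.rIn = 1 ∧ χ.rOut = 2 :=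
    ⟨⟨1, 2, one_pos, one_lt_two⟩, rfl, rfl⟩
  obtain ⟨M, hM⟩ := χ.exists_norm_fderiv_mul_le
  refine ⟨M * (K₀ + K₁), fun v hv ↦ ?_⟩
  set w := radialExtension v
  have hw : ContDiff ℝ 1 w := contDiff_radialExtension hv
  have hχw : ContDiff ℝ 1 fun x ↦ χ x * w x := χ.contDiff.mul hw
  have hsupp : (Function.support fun x ↦ χ x * w x) ⊆ Metric.closedBall 0 2 := by
    refine (Function.support_mul_subset_left _ _).trans ?_
    rw [χ.support_eq, hout]
    exact Metric.ball_subset_closedBall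
  refine ⟨fun x ↦ χ x * w x, hχw, hsupp, fun x hx ↦ ?_, ?_⟩
  · have : χ x = 1 := χ.one_of_mem_closedBall (by simpa [hin] using hx)
    simp [this, w, radialExtension, hx]
  have hpt : ∀ x, ‖fderiv ℝ (fun x ↦ χ x * w x) x‖ ≤ (Metric.closedBall 0 2).indicator
      ((M : ℝ) • ((fun x ↦ ‖w x‖) + fun x ↦ ‖fderiv ℝ w x‖)) x := by
    intro x
    by_cases hx : x ∈ Metric.closedBall (0 : E) 2
    · rw [Set.indicator_of_mem hx]
      exact hM w (hw.differentiable one_ne_zero) x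
    · have hx' : x ∉ tsupport fun x ↦ χ x * w x := fun h ↦
        hx (closure_minimal hsupp Metric.isClosed_closedBall h)
      rw [Set.indicator_of_notMem hx, fderiv_of_notMem_tsupport ℝ hx', norm_zero]
  have hwc : Continuous w := hw.continuous
  have hfwc : Continuous (fderiv ℝ w) := hw.continuous_fderiv one_ne_zero
  set B₁ := μ.restrict (Metric.closedBall (0 : E) 1)
  set B₂ := μ.restrict (Metric.closedBall (0 : E) 2)
  have h₀ : eLpNorm (fun x ↦ ‖w x‖) p B₂ ≤ K₀ * eLpNorm v p B₁ := by
    refine hK₀ v _ hv.continuous (fun x hx ↦ ?_) fun x hx _ ↦ ?_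
    · simp [w, radialExtension, hx]
    · rw [norm_norm]
      exact abs_radialExtension_le v hx
  have h₁ : eLpNorm (fun x ↦ ‖fderiv ℝ w x‖) p B₂ ≤ K₁ * eLpNorm (fderiv ℝ v) p B₁ := by
    rw [← eLpNorm_norm (fderiv ℝ v)]
    refine hK₁ _ _ (hv.continuous_fderiv one_ne_zero).norm (fun x hx ↦ ?_) fun x hx hx2 ↦ ?_
    · rw [fderiv_radialExtension hv, if_pos hx]
    · simp only [norm_norm]
      exact hc v hv x hx hx2
  calc eLpNorm (fderiv ℝ fun x ↦ χ x * w x) p μ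
      ≤ eLpNorm ((Metric.closedBall 0 2).indicator
          ((M : ℝ) • ((fun x ↦ ‖w x‖) + fun x ↦ ‖fderiv ℝ w x‖))) p μ := eLpNorm_mono_real hpt
    _ = eLpNorm ((M : ℝ) • ((fun x ↦ ‖w x‖) + fun x ↦ ‖fderiv ℝ w x‖)) p B₂ :=
        eLpNorm_indicator_eq_eLpNorm_restrict Metric.isClosed_closedBall.measurableSet
    _ ≤ M * (K₀ * eLpNorm v p B₁ + K₁ * eLpNorm (fderiv ℝ v) p B₁) := by
        refine eLpNorm_const_smul_le.trans ?_
        rw [Real.enorm_of_nonneg M.coe_nonneg, ENNReal.ofReal_coe_nnreal]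
        gcongr
        exact (eLpNorm_add_le hwc.norm.aestronglyMeasurable hfwc.norm.aestronglyMeasurable
          hp1).trans (add_le_add h₀ h₁)
    _ ≤ M * ((K₀ + K₁) * eLpNorm v p B₁ + (K₀ + K₁) * eLpNorm (fderiv ℝ v) p B₁) := by
        gcongr
        · exact le_self_add
        · exact le_add_self
    _ = _ := by
        push_cast
        ring

end Extension

section Conversion

lemma Continuous.eLpNorm_restrict_eq_integral {E F : Type*} [NormedAddCommGroup E]
    [ProperSpace E] [MeasurableSpace E] [BorelSpace E]
    [NormedAddCommGroup F] [SecondCountableTopologyEither E F] {μ : Measure E}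
    [IsFiniteMeasureOnCompacts μ] {f : E → F} (hf : Continuous f)
    {s : Set E} (hs : Bornology.IsBounded s) {r : ℝ} (hr : 0 < r) :
    eLpNorm f (ENNReal.ofReal r) (μ.restrict s) =
      ENNReal.ofReal ((∫ x in s, ‖f x‖ ^ r ∂μ) ^ (1 / r)) := by
  have hK : IsCompact (closure s) := hs.isCompact_closure
  obtain ⟨C, hC⟩ := hK.exists_bound_of_continuousOn hf.continuousOn
  have hmem : MemLp f (ENNReal.ofReal r) (μ.restrict (closure s)) := by
    have : IsFiniteMeasure (μ.restrict (closure s)) :=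
      isFiniteMeasure_restrict.2 hK.measure_lt_top.ne
    exact MemLp.of_bound hf.aestronglyMeasurable C
      ((ae_restrict_iff' isClosed_closure.measurableSet).2 (Filter.Eventually.of_forall hC))
  have hmem' := hmem.mono_measure (Measure.restrict_mono (μ := μ) subset_closure le_rfl)
  rw [hmem'.eLpNorm_eq_integral_rpow_norm (by simpa using hr) ENNReal.ofReal_ne_top,
    ENNReal.toReal_ofReal hr.le, one_div]

end Conversion

section SobolevPoincare

variable {E : Type*} [NormedAddCommGroup E] [InnerProductSpace ℝ E] [FiniteDimensional ℝ E]
  [MeasurableSpace E] [BorelSpace E]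

lemma exists_eLpNorm_closedBall_le_eLpNorm_fderiv_add_average (μ : Measure E) [μ.IsAddHaarMeasure]
    {p q ε : ℝ≥0} (hp : 1 ≤ p) (hpn : p < Module.finrank ℝ E)
    (hpq : (p : ℝ)⁻¹ - (Module.finrank ℝ E : ℝ)⁻¹ ≤ (q : ℝ)⁻¹) (hε : ε ≠ 0) :
    ∃ C : ℝ≥0, ∀ v : E → ℝ, ContDiff ℝ 1 v → ∀ A ⊆ Metric.closedBall (0 : E) 1, ε ≤ μ A →
      eLpNorm v q (μ.restrict (Metric.closedBall 0 1)) ≤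
        C * (eLpNorm (fderiv ℝ v) p (μ.restrict (Metric.closedBall 0 1)) +
          (μ A)⁻¹ * ∫⁻ x in A, ‖v x‖ₑ ∂μ) := by
  obtain ⟨K, hK⟩ := exists_contDiff_extension μ (p := p) (by exact_mod_cast hp) ENNReal.coe_ne_top
  set B : Set E := Metric.closedBall 0 1 with hB
  have hBtop : μ B ≠ ∞ := (isCompact_closedBall 0 1).measure_lt_top.ne
  set D : ℝ≥0 := eLpNormLESNormFDerivOfLeConst ℝ μ (Metric.closedBall (0 : E) 2) p q with hD
  have hp' : (1 : ℝ) ≤ p := by exact_mod_cast hp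
  have hp0 : (0 : ℝ) ≤ 1 / p := by positivity
  set a : ℝ≥0∞ :=
    ((ε : ℝ≥0∞)⁻¹ * (((2 : ℝ≥0) : ℝ≥0∞) ^ (p : ℝ) * (2 ^ Module.finrank ℝ E * μ B))) ^ (1 / (p : ℝ))
    with ha
  have ha_top : a ≠ ∞ := by
    refine ENNReal.rpow_ne_top_of_nonneg hp0 (ENNReal.mul_ne_top (by simpa using hε)
      (ENNReal.mul_ne_top (ENNReal.rpow_ne_top_of_nonneg (by positivity) ENNReal.coe_ne_top)
        (ENNReal.mul_ne_top (by finiteness) hBtop)))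
  set b : ℝ≥0∞ := μ B ^ (1 / (p : ℝ)) with hb
  have hb_top : b ≠ ∞ := ENNReal.rpow_ne_top_of_nonneg hp0 hBtop
  refine ⟨D * (K * (a + b + 1).toNNReal), fun v hv A hA hεA ↦ ?_⟩
  obtain ⟨u, hu, hus, huv, hle⟩ := hK v hv
  set G := eLpNorm (fderiv ℝ v) p (μ.restrict B)
  set M := (μ A)⁻¹ * ∫⁻ x in A, ‖v x‖ₑ ∂μ
  have hA0 : μ A ≠ 0 := ((ENNReal.coe_pos.2 (pos_iff_ne_zero.2 hε)).trans_le hεA).ne'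
  have hpoinc : eLpNorm v p (μ.restrict B) ≤ a * G + b * M := by
    have h := eLpNorm_le_eLpNorm_fderiv_add_average μ hv Metric.isClosed_closedBall.measurableSet
      (convex_closedBall (0 : E) 1) (d := 2) (fun x hx y hy ↦ ?_) hA hA0
      (measure_ne_top_of_subset hA hBtop) hp'
    · rw [ENNReal.ofReal_coe_nnreal] at h
      refine h.trans ?_
      rw [ha]
      push_cast
      gcongr
    · rw [← edist_eq_enorm_sub, edist_dist]
      have := dist_triangle_right y x 0
      rw [Metric.mem_closedBall] at hx hy
      exact ENNReal.ofReal_le_of_le_toReal (by rw [ENNReal.toReal_ofNat]; linarith)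
  calc eLpNorm v q (μ.restrict B) = eLpNorm u q (μ.restrict B) := by
        refine eLpNorm_congr_ae ((ae_restrict_iff' Metric.isClosed_closedBall.measurableSet).2
          (Filter.Eventually.of_forall fun x hx ↦ ?_))
        exact (huv x (by simpa [hB] using hx)).symm
    _ ≤ eLpNorm u q μ := eLpNorm_mono_measure u Measure.restrict_le_self
    _ ≤ D * eLpNorm (fderiv ℝ u) p μ := eLpNorm_le_eLpNorm_fderiv_of_le μ hu hus hp hpn hpq
        Metric.isBounded_closedBall
    _ ≤ D * (K * ((a * G + b * M) + G)) := by
        gcongr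
        exact hle.trans (by gcongr)
    _ ≤ D * (K * ((a + b + 1) * (G + M))) := by
        gcongr
        calc a * G + b * M + G ≤ a * G + b * M + G + (a * M + b * G + M) := le_self_add
          _ = (a + b + 1) * (G + M) := by ring
    _ = _ := by
        rw [ENNReal.coe_mul, ENNReal.coe_mul, ENNReal.coe_toNNReal (by finiteness)]
        ring

end SobolevPoincare

/-- Poincaré inequality on the unit ball of `ℝᵐ` with the mean replaced by the
average over an arbitrary measurable set `A ⊆ B(0,1)` of volume greater than `ε`:
for `1 ≤ p < m`, `1 ≤ q ≤ mp/(m-p)` there is `C > 0` such that for every `C¹`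
function `v` one has
`(∫_{B} |v|^q)^{1/q} ≤ C ((∫_B ‖Dv‖^p)^{1/p} + |A|⁻¹ ∫_A |v|)`. -/
theorem poincare_ball_average (m : ℕ) (hm : 1 ≤ m) (p q ε : ℝ)
    (hp : 1 ≤ p) (hpm : p < m) (hq1 : 1 ≤ q) (hq2 : q ≤ m * p / (m - p)) (hε : 0 < ε) :
    ∃ C : ℝ, 0 < C ∧ ∀ v : EuclideanSpace ℝ (Fin m) → ℝ, ContDiff ℝ 1 v →
      ∀ A : Set (EuclideanSpace ℝ (Fin m)), MeasurableSet A → A ⊆ Metric.ball 0 1 →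
      ε < (volume A).toReal →
      (∫ x in Metric.ball (0 : EuclideanSpace ℝ (Fin m)) 1, |v x| ^ q) ^ (1 / q) ≤
        C * ((∫ x in Metric.ball (0 : EuclideanSpace ℝ (Fin m)) 1,
                ‖fderiv ℝ v x‖ ^ p) ^ (1 / p) +
              ((volume A).toReal)⁻¹ * ∫ x in A, |v x|) := by
  have hm0 : (0 : ℝ) < m := by linarith
  have hp0 : 0 < p := by linarith
  have hq0 : 0 < q := by linarith
  have hpq : p⁻¹ - (m : ℝ)⁻¹ ≤ q⁻¹ := by
    rw [inv_sub_inv hp0.ne' hm0.ne', ← inv_div, mul_comm p]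
    exact inv_anti₀ hq0 hq2
  lift p to ℝ≥0 using hp0.le
  lift q to ℝ≥0 using hq0.le
  lift ε to ℝ≥0 using hε.le
  obtain ⟨C, hC⟩ := exists_eLpNorm_closedBall_le_eLpNorm_fderiv_add_average
    (volume : Measure (EuclideanSpace ℝ (Fin m))) (p := p) (q := q) (ε := ε) (by exact_mod_cast hp)
    (by rw [finrank_euclideanSpace_fin]; exact_mod_cast hpm)
    (by rwa [finrank_euclideanSpace_fin]) (by exact_mod_cast hε.ne')
  refine ⟨C + 1, by positivity, fun v hv A hA hAB hεA ↦ ?_⟩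
  have hball : (volume : Measure (EuclideanSpace ℝ (Fin m))).restrict (Metric.closedBall 0 1) =
      volume.restrict (Metric.ball 0 1) := by
    refine Measure.restrict_congr_set (ae_eq_of_subset_of_measure_ge Metric.ball_subset_closedBall
      ?_ Metric.isOpen_ball.measurableSet.nullMeasurableSet (measure_closedBall_lt_top).ne).symm
    simp [Measure.addHaar_closedBall _ _ zero_le_one]
  have hAtop : volume A ≠ ∞ := measure_ne_top_of_subset hAB measure_ball_lt_top.ne
  have hA0 : 0 < (volume A).toReal := hε.trans hεA
  have h := hC v hv A (hAB.trans Metric.ball_subset_closedBall)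
    ((ENNReal.coe_le_iff).2 fun b hb ↦ by
      rw [hb] at hεA; exact_mod_cast hεA.le)
  have hint : IntegrableOn v A volume :=
    (hv.continuous.locallyIntegrable.integrableOn_isCompact (isCompact_closedBall 0 1)).mono_set
      (hAB.trans Metric.ball_subset_closedBall)
  rw [hball, ← ENNReal.ofReal_coe_nnreal (p := p), ← ENNReal.ofReal_coe_nnreal (p := q),
    hv.continuous.eLpNorm_restrict_eq_integral Metric.isBounded_ball hq0,
    (hv.continuous_fderiv one_ne_zero).eLpNorm_restrict_eq_integral Metric.isBounded_ball hp0,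
    ← ofReal_integral_norm_eq_lintegral_enorm hint, ← ENNReal.ofReal_toReal hAtop,
    ← ENNReal.ofReal_inv_of_pos hA0, ← ENNReal.ofReal_mul (by positivity),
    ← ENNReal.ofReal_add (by positivity) (by positivity), ← ENNReal.ofReal_coe_nnreal (p := C),
    ← ENNReal.ofReal_mul (by positivity), ENNReal.ofReal_le_ofReal_iff (by positivity)] at h
  simp only [Real.norm_eq_abs] at h
  refine h.trans ?_
  gcongr
  linarith
end

section
/- Let m ≥ 1 be an integer and let α > 0 and p ≥ 1 be real numbers with (α + 2)·p < m ≤ 2·(α + 1)·p. Define f : ℝ^m → ℝ by f(x) = ‖x‖^{−α}. Then the function x ↦ ‖iteratedFDeriv ℝ 2 f x‖^p IS Lebesgue-integrable on the open unit ball B(0,1) ⊆ ℝ^m, while the function x ↦ ‖fderiv ℝ f x‖^{2p} is NOT Lebesgue-integrable on B(0,1). -/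
open MeasureTheory

section NormRpow

variable {E : Type*} [NormedAddCommGroup E] [InnerProductSpace ℝ E]

theorem hasFDerivAt_norm_rpow_of_ne {x : E} (hx : x ≠ 0) (s : ℝ) :
    HasFDerivAt (fun y : E => ‖y‖ ^ s) ((s * ‖x‖ ^ (s - 2)) • innerSL ℝ x) x := by
  have hsq : ∀ (y : E) (t : ℝ), (‖y‖ ^ 2) ^ t = ‖y‖ ^ (2 * t) := fun y t => by
    rw [← Real.rpow_natCast, ← Real.rpow_mul (norm_nonneg y), Nat.cast_ofNat]
  have h := (hasStrictFDerivAt_norm_sq x).hasFDerivAt.rpow_const (p := s / 2)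
    (Or.inl (pow_ne_zero 2 (norm_ne_zero_iff.2 hx)))
  simp only [hsq] at h
  convert! h using 1
  · ext y
    congr 1
    ring
  · rw [← Nat.cast_smul_eq_nsmul ℝ, smul_smul, show 2 * (s / 2 - 1) = s - 2 by ring]
    congr 1
    push_cast
    ring

theorem norm_fderiv_norm_rpow_of_ne {x : E} (hx : x ≠ 0) (s : ℝ) :
    ‖fderiv ℝ (fun y : E => ‖y‖ ^ s) x‖ = |s| * ‖x‖ ^ (s - 1) := by
  have h0 : 0 < ‖x‖ := norm_pos_iff.2 hx
  rw [(hasFDerivAt_norm_rpow_of_ne hx s).fderiv, norm_smul, innerSL_apply_norm, norm_mul,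
    Real.norm_eq_abs, Real.norm_of_nonneg (by positivity), mul_assoc, ← Real.rpow_add_one h0.ne']
  ring_nf

theorem norm_iteratedFDeriv_two_norm_rpow_le {x : E} (hx : x ≠ 0) (s : ℝ) :
    ‖iteratedFDeriv ℝ 2 (fun y : E => ‖y‖ ^ s) x‖ ≤
      |s| * (1 + |s - 2|) * ‖x‖ ^ (s - 2) := by
  have h0 : 0 < ‖x‖ := norm_pos_iff.2 hx
  obtain ⟨L, hL, hLn⟩ : ∃ L : E →L[ℝ] E →L[ℝ] ℝ, (∀ y, L y = innerSL ℝ y) ∧ ‖L‖ ≤ 1 :=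
    ⟨innerSL ℝ, fun _ => rfl, norm_innerSL_le ℝ⟩
  have hev : fderiv ℝ (fun y : E => ‖y‖ ^ s) =ᶠ[nhds x]
      fun y => (s * ‖y‖ ^ (s - 2)) • L y := by
    filter_upwards [isOpen_ne.mem_nhds hx] with y hy
    rw [hL]
    exact (hasFDerivAt_norm_rpow_of_ne hy s).fderiv
  have hd := ((hasFDerivAt_norm_rpow_of_ne hx (s - 2)).const_mul s).fun_smul L.hasFDerivAt
  rw [← norm_iteratedFDeriv_fderiv, norm_iteratedFDeriv_one, hev.fderiv_eq, hd.fderiv]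
  refine (norm_add_le _ _).trans ?_
  have h₁ : ‖(s * ‖x‖ ^ (s - 2)) • L‖ ≤ |s| * ‖x‖ ^ (s - 2) := by
    refine (ContinuousLinearMap.opNorm_smul_le _ L).trans ?_
    rw [norm_mul, Real.norm_eq_abs, Real.norm_of_nonneg (by positivity)]
    exact mul_le_of_le_one_right (by positivity) hLn
  have h₂ : ‖(s • ((s - 2) * ‖x‖ ^ (s - 2 - 2)) • innerSL ℝ x).smulRight (L x)‖ =
      |s| * |s - 2| * ‖x‖ ^ (s - 2) := by
    have hpow : ‖x‖ ^ (s - 2 - 2) * ‖x‖ * ‖x‖ = ‖x‖ ^ (s - 2) := by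
      rw [← Real.rpow_add_one h0.ne', ← Real.rpow_add_one h0.ne']
      ring_nf
    rw [hL, ContinuousLinearMap.norm_smulRight_apply, norm_smul, norm_smul, innerSL_apply_norm,
      norm_mul, Real.norm_eq_abs, Real.norm_eq_abs,
      Real.norm_of_nonneg (r := ‖x‖ ^ _) (by positivity), ← hpow]
    ring
  calc _ ≤ |s| * ‖x‖ ^ (s - 2) + |s| * |s - 2| * ‖x‖ ^ (s - 2) := add_le_add h₁ h₂.le
    _ = _ := by ring

theorem contDiffAt_norm_rpow_of_ne {x : E} (hx : x ≠ 0) (s : ℝ) {n : WithTop ℕ∞} :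
    ContDiffAt ℝ n (fun y : E => ‖y‖ ^ s) x :=
  (contDiffAt_norm ℝ hx).rpow_const_of_ne (norm_ne_zero_iff.2 hx)

theorem continuousOn_iteratedFDeriv_norm_rpow (s : ℝ) (n : ℕ) :
    ContinuousOn (iteratedFDeriv ℝ n (fun y : E => ‖y‖ ^ s)) {0}ᶜ := fun _ hx =>
  ((contDiffAt_norm_rpow_of_ne hx s (n := n)).continuousAt_iteratedFDeriv
    le_rfl).continuousWithinAt

variable [FiniteDimensional ℝ E] [Nontrivial E] [MeasurableSpace E] [BorelSpace E]
  (μ : Measure E) [μ.IsAddHaarMeasure]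

theorem integrableOn_ball_norm_rpow_iff (s : ℝ) :
    IntegrableOn (fun x : E => ‖x‖ ^ s) (Metric.ball 0 1) μ ↔ -(Module.finrank ℝ E : ℝ) < s := by
  have hdim : 1 ≤ Module.finrank ℝ E := Module.finrank_pos
  rw [integrableOn_fun_norm_addHaar μ (f := fun t : ℝ => t ^ s),
    integrableOn_congr_fun (g := fun t : ℝ => t ^ ((Module.finrank ℝ E : ℝ) - 1 + s)) _
      measurableSet_Ioo, intervalIntegral.integrableOn_Ioo_rpow_iff zero_lt_one]
  · constructor <;> intro h <;> linarith
  · intro t ht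
    simp only [smul_eq_mul]
    rw [Real.rpow_add ht.1, ← Real.rpow_natCast, Nat.cast_sub hdim, Nat.cast_one]

end NormRpow

/-- For `f(x) = ‖x‖^{-α}` on `ℝᵐ` with `(α + 2)p < m ≤ 2(α + 1)p`, the function
`‖D²f‖^p` is Lebesgue-integrable on the unit ball while `‖Df‖^{2p}` is not: the core
of the failure of the Gagliardo–Nirenberg interpolation inequality for the intrinsic
second-order Sobolev space. -/
theorem rpow_integrable_second_not_first (m : ℕ) (hm : 1 ≤ m) (α p : ℝ) (hα : 0 < α)
    (hp : 1 ≤ p) (h₁ : (α + 2) * p < m) (h₂ : (m : ℝ) ≤ 2 * (α + 1) * p) :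
    IntegrableOn
        (fun x : EuclideanSpace ℝ (Fin m) =>
          ‖iteratedFDeriv ℝ 2 (fun y : EuclideanSpace ℝ (Fin m) => ‖y‖ ^ (-α)) x‖ ^ p)
        (Metric.ball 0 1) volume ∧
      ¬ IntegrableOn
          (fun x : EuclideanSpace ℝ (Fin m) =>
            ‖fderiv ℝ (fun y : EuclideanSpace ℝ (Fin m) => ‖y‖ ^ (-α)) x‖ ^ (2 * p))
          (Metric.ball 0 1) volume := by
  have : Nontrivial (EuclideanSpace ℝ (Fin m)) :=
    Module.nontrivial_of_finrank_pos (R := ℝ) (by rwa [finrank_euclideanSpace_fin])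
  have hne : ∀ᵐ x : EuclideanSpace ℝ (Fin m) ∂volume.restrict (Metric.ball 0 1), x ≠ 0 :=
    ae_restrict_of_ae (Measure.ae_ne volume 0)
  constructor
  · have hint := ((integrableOn_ball_norm_rpow_iff
      (volume : Measure (EuclideanSpace ℝ (Fin m))) ((-α - 2) * p)).2
        (by rw [finrank_euclideanSpace_fin]; linarith)).const_mul
          ((|-α| * (1 + |-α - 2|)) ^ p)
    refine hint.mono' ?_ ?_
    · have hmeas : AEStronglyMeasurable
          (iteratedFDeriv ℝ 2 (fun y : EuclideanSpace ℝ (Fin m) => ‖y‖ ^ (-α))) volume := by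
        rw [← restrict_compl_singleton (μ := volume) (0 : EuclideanSpace ℝ (Fin m))]
        exact (continuousOn_iteratedFDeriv_norm_rpow (-α) 2).aestronglyMeasurable
          (measurableSet_singleton _).compl
      exact (hmeas.norm.aemeasurable.pow_const p).aestronglyMeasurable.restrict
    · filter_upwards [hne] with x hx
      rw [Real.norm_of_nonneg (by positivity), Real.rpow_mul (norm_nonneg x),
        ← Real.mul_rpow (by positivity) (by positivity)]
      exact Real.rpow_le_rpow (norm_nonneg _) (norm_iteratedFDeriv_two_norm_rpow_le hx _)
        (by linarith)
  · intro h
    have hpow : IntegrableOn (fun x : EuclideanSpace ℝ (Fin m) =>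
        ‖x‖ ^ ((-α - 1) * (2 * p))) (Metric.ball 0 1) volume := by
      refine (h.const_mul ((α ^ (2 * p))⁻¹)).congr ?_
      filter_upwards [hne] with x hx
      rw [norm_fderiv_norm_rpow_of_ne hx, abs_neg, abs_of_pos hα,
        Real.mul_rpow hα.le (by positivity), ← Real.rpow_mul (norm_nonneg x),
        inv_mul_cancel_left₀ (by positivity)]
    rw [integrableOn_ball_norm_rpow_iff, finrank_euclideanSpace_fin] at hpow
    linarith
end
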